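/- arXiv:2602.09298 — 6 statements merged into one kernel-verified Lean document; each statement's English description precedes it below -/
import Mathlib

section
/- Let p be an odd prime, K a field of characteristic p, and a, b, c, d, e ∈ K with a ≠ 0. Then I_p(a, b − c/a, −c, d + c, e) = I_p(a, b, c, d, e) + e^p·(c^p − c); that is, the Weyl group generator s₁ maps the integral of motion I_p to I_p + t^p·(α₁^p − α₁). -/
open MvPolynomial

noncomputable section

/-- The polynomial ring `R = 𝔽_p[f, g, α₁, α₂, t]`, with the five indeterminates
indexed by `0, 1, 2, 3, 4` respectively. -/
abbrev R (p : ℕ) := MvPolynomial (Fin 5) (ZMod p)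

def fP (p : ℕ) : R p := X 0
def gP (p : ℕ) : R p := X 1
def a1P (p : ℕ) : R p := X 2
def a2P (p : ℕ) : R p := X 3
def tP (p : ℕ) : R p := X 4

/-- `h = f·g·(t·g − 1)·(t·f − 1) + α₁·(t·g − 1) − α₂·(t·f − 1)`. -/
def hP (p : ℕ) : R p :=
  fP p * gP p * (tP p * gP p - 1) * (tP p * fP p - 1)
    + a1P p * (tP p * gP p - 1) - a2P p * (tP p * fP p - 1)

def A0 (p : ℕ) : Matrix (Fin 2) (Fin 2) (R p) :=
  !![-(a1P p) * gP p + fP p * gP p ^ 2 - tP p * fP p ^ 2 * gP p ^ 2, -(fP p * gP p);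
     fP p * gP p * hP p - a1P p * a2P p, -(a2P p) * fP p - fP p ^ 2 * gP p + tP p * fP p ^ 2 * gP p ^ 2]

def A1 (p : ℕ) : Matrix (Fin 2) (Fin 2) (R p) := !![0, 1; hP p, 0]

def A2 (p : ℕ) : Matrix (Fin 2) (Fin 2) (R p) :=
  !![tP p, 0; 1 - tP p ^ 2 * fP p * gP p, -(tP p)]

def A3 (p : ℕ) : Matrix (Fin 2) (Fin 2) (R p) := !![0, 0; -(tP p ^ 2), 0]

/-- The Lax coefficient matrix `A(z) = A₀ + z·A₁ + z²·A₂ + z³·A₃`, with entries in any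
commutative ring `S` receiving a ring homomorphism from `R`. -/
def AM (p : ℕ) {S : Type*} [CommRing S] (φ : R p →+* S) (z : S) : Matrix (Fin 2) (Fin 2) S :=
  (A0 p).map φ + z • (A1 p).map φ + z ^ 2 • (A2 p).map φ + z ^ 3 • (A3 p).map φ

/-- The integral of motion `I_p = Tr[A(p−1)·A(p−2)·⋯·A(1)·A(0)] ∈ R`. -/
def Ip (p : ℕ) : R p :=
  Matrix.trace (((List.range p).reverse.map (fun k => AM p (RingHom.id (R p)) (k : R p))).prod)

/-- Evaluation of a polynomial `P ∈ R` at a point `(a,b,c,d,e) ∈ K⁵` of a field (or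
commutative ring) of characteristic `p`. -/
def evalP (p : ℕ) (P : R p) (K : Type*) [CommRing K] [CharP K p] (a b c d e : K) : K :=
  eval₂ (ZMod.castHom (dvd_refl p) K) ![a, b, c, d, e] P

end

noncomputable section

/-- The Lax matrix `A(z)` of the fourth Painlevé equation at the point `(a, b, c, d, e)`. -/
def laxMatrix {S : Type*} [CommRing S] (a b c d e z : S) : Matrix (Fin 2) (Fin 2) S :=
  !![-c * b + a * b ^ 2 - e * a ^ 2 * b ^ 2 + z ^ 2 * e, -(a * b) + z;
     a * b * (a * b * (e * b - 1) * (e * a - 1) + c * (e * b - 1) - d * (e * a - 1)) - c * d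
       + z * (a * b * (e * b - 1) * (e * a - 1) + c * (e * b - 1) - d * (e * a - 1))
       + z ^ 2 * (1 - e ^ 2 * a * b) - z ^ 3 * e ^ 2,
     -d * a - a ^ 2 * b + e * a ^ 2 * b ^ 2 - z ^ 2 * e]

/-- The gauge transform `G(z + 1) * A(z) * G(z)⁻¹` of the Lax matrix, where `G` is `laxGauge`. -/
def reducedLaxMatrix {S : Type*} [CommRing S] (a b c d e z : S) : Matrix (Fin 2) (Fin 2) S :=
  !![b * (a * b - c), z - a * b;
     e * b * (a * b - c) + z ^ 2 + z * (a * b) + (a * b) ^ 2 + (d - c) * (z + a * b) - c * d,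
     e * z - d * a - a ^ 2 * b - e * (a * b)]

/-- The gauge matrix `G(z)` that lowers the degree of the Lax matrix. -/
def laxGauge {S : Type*} [CommRing S] (a b e z : S) : Matrix (Fin 2) (Fin 2) S :=
  !![1, 0; e * (z + a * b), 1]

lemma laxGauge_mul_laxMatrix {S : Type*} [CommRing S] (a b c d e z : S) :
    laxGauge a b e (z + 1) * laxMatrix a b c d e z =
      reducedLaxMatrix a b c d e z * laxGauge a b e z := by
  ext i j
  fin_cases i <;> fin_cases j <;>
    simp [laxGauge, laxMatrix, reducedLaxMatrix, Matrix.mul_apply] <;> ring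

lemma isUnit_laxGauge {S : Type*} [CommRing S] (a b e z : S) : IsUnit (laxGauge a b e z) := by
  rw [Matrix.isUnit_iff_isUnit_det]
  simp [laxGauge, Matrix.det_fin_two]

/-- The generator `s₁` acts on the reduced Lax matrix as the translation `z ↦ z + α₁`. -/
lemma reducedLaxMatrix_s1 {K : Type*} [Field K] (a b c d e z : K) (ha : a ≠ 0) :
    reducedLaxMatrix a (b - c / a) (-c) (d + c) e z = reducedLaxMatrix a b c d e (z + c) := by
  have hab : a * (b - c / a) = a * b - c := by field_simp
  have h11 : (b - c / a) * (a * b) = b * (a * b - c) := by field_simp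
  have ha2 : a ^ 2 * (b - c / a) = a * (a * b - c) := by field_simp
  ext i j
  fin_cases i <;> fin_cases j <;> simp [reducedLaxMatrix, hab, ha2]
  · linear_combination h11
  · ring
  · linear_combination e * h11
  · ring

lemma gauge_mul_list_prod {M : Type*} [Monoid M] {G A B : ℕ → M}
    (h : ∀ k, G (k + 1) * A k = B k * G k) (n : ℕ) :
    G n * ((List.range n).reverse.map A).prod = ((List.range n).reverse.map B).prod * G 0 := by
  induction n with
  | zero => simp
  | succ n ih =>
    rw [List.range_succ, List.reverse_append, List.map_append, List.map_append, List.prod_append,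
      List.prod_append, mul_assoc (List.prod _), ← ih]
    simp [← mul_assoc, h]

lemma evalP_Ip (p : ℕ) (K : Type*) [CommRing K] [CharP K p] (a b c d e : K) :
    evalP p (Ip p) K a b c d e =
      (((List.range p).reverse.map fun k : ℕ => laxMatrix a b c d e (k : K)).prod).trace := by
  set φ : R p →+* K := eval₂Hom (ZMod.castHom (dvd_refl p) K) ![a, b, c, d, e] with hφ
  have hmap : ∀ k : ℕ, φ.mapMatrix (AM p (RingHom.id (R p)) (k : R p)) =
      laxMatrix a b c d e (k : K) := by
    intro k
    ext i j
    fin_cases i <;> fin_cases j <;>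
      simp [hφ, AM, laxMatrix, A0, A1, A2, A3, hP, fP, gP, a1P, a2P, tP] <;> ring
  change φ (Ip p) = _
  have hcast : (do let k ← (List.range p).reverse; pure (k : R p)) =
      (List.range p).reverse.map fun k : ℕ => (k : R p) := by
    exact List.flatMap_pure_eq_map _ _
  rw [Ip, AddMonoidHom.map_trace φ, ← RingHom.mapMatrix_apply, map_list_prod, hcast,
    List.map_map, List.map_map]
  exact congrArg (fun A : ℕ → Matrix (Fin 2) (Fin 2) K =>
    (List.map A (List.range p).reverse).prod.trace) (_root_.funext hmap)

lemma evalP_Ip_eq_trace_reduced (p : ℕ) (K : Type*) [CommRing K] [CharP K p] (a b c d e : K) :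
    evalP p (Ip p) K a b c d e =
      (((List.range p).reverse.map fun k : ℕ => reducedLaxMatrix a b c d e (k : K)).prod).trace := by
  have h := gauge_mul_list_prod (G := fun k : ℕ => laxGauge a b e (k : K))
    (A := fun k : ℕ => laxMatrix a b c d e (k : K))
    (B := fun k : ℕ => reducedLaxMatrix a b c d e (k : K))
    (fun k => by simpa using laxGauge_mul_laxMatrix a b c d e (k : K)) p
  simp only [CharP.cast_eq_zero, Nat.cast_zero] at h
  obtain ⟨u, hu⟩ := isUnit_laxGauge a b e (0 : K)
  rw [← hu] at h
  rw [evalP_Ip, ← Matrix.trace_units_conj u, h, Units.mul_inv_cancel_right]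

/-- The trace of a product of matrices as a sum over closed walks. -/
lemma trace_list_prod_eq_sum {S ι : Type*} [CommRing S] [Fintype ι] [DecidableEq ι]
    (B : ℕ → Matrix ι ι S) (n : ℕ) :
    (((List.range (n + 1)).reverse.map B).prod).trace =
      ∑ w : ZMod (n + 1) → ι, ∏ k, B k.val (w (k + 1)) (w k) := by
  have entry : ∀ (n : ℕ) (i j : ι), (((List.range (n + 1)).reverse.map B).prod) i j =
      ∑ w : Fin (n + 1) → ι, if w 0 = j then
        B n i (w (Fin.last n)) * ∏ k : Fin n, B k (w k.succ) (w k.castSucc) else 0 := by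
    intro n
    induction n with
    | zero =>
      intro i j
      rw [← (Equiv.funUnique (Fin 1) ι).symm.sum_comp]
      simp
    | succ n ih =>
      intro i j
      rw [List.range_succ, List.reverse_append, List.map_append, List.prod_append,
        ← (Fin.snocEquiv fun _ : Fin (n + 2) => ι).sum_comp, Fintype.sum_prod_type]
      simp only [List.reverse_singleton, List.map_singleton, List.prod_singleton,
        Matrix.mul_apply, ih, Finset.mul_sum]
      refine Finset.sum_congr rfl fun l _ => Finset.sum_congr rfl fun w _ => ?_
      have h0 : Fin.snoc (α := fun _ => ι) w l 0 = w 0 := by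
        rw [← Fin.castSucc_zero, Fin.snoc_castSucc]
      simp only [Fin.snocEquiv_apply, h0, mul_ite, mul_zero, Fin.snoc_last,
        Fin.prod_univ_castSucc (n := n), Fin.snoc_castSucc, Fin.succ_last]
      simp only [← Fin.castSucc_succ, Fin.snoc_castSucc]
      simp [mul_comm]
  simp only [Matrix.trace, Matrix.diag_apply, entry]
  rw [Finset.sum_comm]
  refine Finset.sum_congr rfl fun w _ => ?_
  rw [Finset.sum_ite_eq, if_pos (Finset.mem_univ _)]
  refine Eq.trans ?_ (Fin.prod_univ_castSucc fun k : Fin (n + 1) => B k (w (k + 1)) (w k)).symm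
  simp [mul_comm]

section ArtinSchreier

variable {p : ℕ} [Fact p.Prime] {K : Type*} [Field K] [CharP K p]

lemma sum_add_cast_pow_of_lt (x : K) {j : ℕ} (hj : j < p) :
    ∑ k : ZMod p, (x + ZMod.castHom (dvd_refl p) K k) ^ j =
      ∑ k : ZMod p, ZMod.castHom (dvd_refl p) K k ^ j := by
  simp only [add_comm x, add_pow]
  rw [Finset.sum_comm, Finset.sum_range_succ, Finset.sum_eq_zero, zero_add]
  · simp
  · intro i hi
    have h := FiniteField.sum_pow_lt_card_sub_one (ZMod p) i
      (by rw [ZMod.card]; have := Finset.mem_range.1 hi; omega)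
    rw [← Finset.sum_mul, ← Finset.sum_mul]
    simp only [← map_pow, ← map_sum, h, map_zero, zero_mul]

lemma sum_add_cast_pow_eq_zero (x : K) {j : ℕ} (hj : j < p - 1) :
    ∑ k : ZMod p, (x + ZMod.castHom (dvd_refl p) K k) ^ j = 0 := by
  rw [sum_add_cast_pow_of_lt x (by omega)]
  simp only [← map_pow, ← map_sum]
  rw [FiniteField.sum_pow_lt_card_sub_one (ZMod p) j (by rwa [ZMod.card]), map_zero]

lemma add_cast_pow_char (x : K) (k : ZMod p) :
    (x + ZMod.castHom (dvd_refl p) K k) ^ p = x ^ p + ZMod.castHom (dvd_refl p) K k := by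
  rw [add_pow_char, ← map_pow, ZMod.pow_card]

lemma sum_add_cast_pow (x : K) {j : ℕ} (hj : j < 2 * p - 1) :
    ∑ k : ZMod p, (x + ZMod.castHom (dvd_refl p) K k) ^ j =
      ∑ k : ZMod p, ZMod.castHom (dvd_refl p) K k ^ j := by
  rcases lt_or_ge j p with h | h
  · exact sum_add_cast_pow_of_lt x h
  obtain ⟨i, rfl⟩ := Nat.exists_eq_add_of_le h
  have hp := (Fact.out : p.Prime).one_lt
  have reduce : ∀ y : K, ∑ k : ZMod p, (y + ZMod.castHom (dvd_refl p) K k) ^ (p + i) =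
      ∑ k : ZMod p, ZMod.castHom (dvd_refl p) K k ^ (i + 1) := by
    intro y
    rw [← sum_add_cast_pow_of_lt y (show i + 1 < p by omega)]
    have h0 := sum_add_cast_pow_eq_zero (p := p) y (show i < p - 1 by omega)
    have hk : ∀ k : ZMod p, (y + ZMod.castHom (dvd_refl p) K k) ^ (p + i) =
        (y ^ p - y) * (y + ZMod.castHom (dvd_refl p) K k) ^ i +
          (y + ZMod.castHom (dvd_refl p) K k) ^ (i + 1) := by
      intro k
      rw [pow_add, add_cast_pow_char]
      ring
    simp only [hk, Finset.sum_add_distrib, ← Finset.mul_sum, h0, mul_zero, zero_add]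
  rw [reduce x, ← reduce 0]
  simp

lemma sum_eval_add_cast (Q : Polynomial K) (hQ : Q.natDegree < 2 * p - 1) (x : K) :
    ∑ k : ZMod p, Q.eval (x + ZMod.castHom (dvd_refl p) K k) =
      ∑ k : ZMod p, Q.eval (ZMod.castHom (dvd_refl p) K k) := by
  simp only [Polynomial.eval_eq_sum_range]
  rw [Finset.sum_comm, Finset.sum_comm (s := Finset.univ)]
  refine Finset.sum_congr rfl fun j hj => ?_
  rw [← Finset.mul_sum, ← Finset.mul_sum,
    sum_add_cast_pow x (by have := Finset.mem_range.1 hj; omega)]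

lemma prod_add_cast (x : K) :
    ∏ k : ZMod p, (x + ZMod.castHom (dvd_refl p) K k) = x ^ p - x := by
  have h : (∏ k : ZMod p, (Polynomial.X - Polynomial.C k)) =
      (Polynomial.X ^ p - Polynomial.X : Polynomial (ZMod p)) := by
    have hp := (Fact.out : p.Prime).one_lt
    have hroots := FiniteField.roots_X_pow_card_sub_X (ZMod p)
    rw [ZMod.card] at hroots
    rw [Finset.prod, ← hroots]
    refine Polynomial.prod_multiset_X_sub_C_of_monic_of_roots_card_eq
      (Polynomial.monic_X_pow_sub (by simpa using hp)) ?_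
    rw [hroots, FiniteField.X_pow_card_sub_X_natDegree_eq _ hp]
    simp [ZMod.card]
  have h' := congrArg (Polynomial.eval₂ (ZMod.castHom (dvd_refl p) K) x) h
  simp only [Polynomial.eval₂_finsetProd, Polynomial.eval₂_sub, Polynomial.eval₂_X,
    Polynomial.eval₂_C, Polynomial.eval₂_pow] at h'
  rw [← h', ← Fintype.prod_equiv (Equiv.neg (ZMod p)) _ _ fun k => rfl]
  simp [sub_eq_add_neg]

lemma prod_add_mul_cast (t u : K) :
    ∏ k : ZMod p, (u + t * ZMod.castHom (dvd_refl p) K k) = u ^ p - t ^ (p - 1) * u := by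
  have hp := (Fact.out : p.Prime).one_lt
  rcases eq_or_ne t 0 with rfl | ht
  · simp [zero_pow (show p - 1 ≠ 0 by omega), ZMod.card]
  have h : ∀ k : ZMod p, u + t * ZMod.castHom (dvd_refl p) K k =
      t * (u / t + ZMod.castHom (dvd_refl p) K k) := fun k => by field_simp
  simp only [h]
  rw [Finset.prod_mul_distrib, prod_add_cast, Finset.prod_const, Finset.card_univ, ZMod.card]
  obtain ⟨n, rfl⟩ : ∃ n, p = n + 1 := ⟨p - 1, by omega⟩
  simp only [Nat.add_sub_cancel, div_pow, pow_succ]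
  field_simp

/-- The contribution of the closed walk `w` to the trace of `B(x + p - 1) ⋯ B(x + 1) B(x)`, as a
polynomial in `x`. -/
def walkPoly (B : Matrix (Fin 2) (Fin 2) (Polynomial K)) (w : ZMod p → Fin 2) : Polynomial K :=
  ∏ k, (B (w (k + 1)) (w k)).comp
    (Polynomial.X + Polynomial.C (ZMod.castHom (dvd_refl p) K k))

lemma eval_walkPoly (B : Matrix (Fin 2) (Fin 2) (Polynomial K)) (w : ZMod p → Fin 2) (x : K) :
    (walkPoly B w).eval x =
      ∏ k, (B (w (k + 1)) (w k)).eval (x + ZMod.castHom (dvd_refl p) K k) := by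
  simp [walkPoly, Polynomial.eval_prod]

lemma eval_walkPoly_shift (B : Matrix (Fin 2) (Fin 2) (Polynomial K)) (w : ZMod p → Fin 2)
    (s : ZMod p) (x : K) :
    (walkPoly B fun k => w (k - s)).eval x =
      (walkPoly B w).eval (x + ZMod.castHom (dvd_refl p) K s) := by
  rw [eval_walkPoly, eval_walkPoly]
  refine Fintype.prod_equiv (Equiv.subRight s) _ _ fun k => ?_
  simp only [Equiv.subRight_apply, map_sub, sub_add_eq_add_sub]
  congr 1
  ring

lemma natDegree_walkPoly_lt (hodd : p ≠ 2) (B : Matrix (Fin 2) (Fin 2) (Polynomial K))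
    (hB : ∀ i j, 2 * (B i j).natDegree + j.val ≤ 3 + i.val) (w : ZMod p → Fin 2) :
    (walkPoly B w).natDegree < 2 * p - 1 := by
  have hp := (Fact.out : p.Prime).two_le
  have hdeg : (walkPoly B w).natDegree ≤ ∑ k, (B (w (k + 1)) (w k)).natDegree := by
    refine (Polynomial.natDegree_prod_le _ _).trans (Finset.sum_le_sum fun k _ => ?_)
    rw [Polynomial.natDegree_comp, Polynomial.natDegree_X_add_C, mul_one]
  have hsum := Finset.sum_le_sum fun k (_ : k ∈ Finset.univ) => hB (w (k + 1)) (w k)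
  have hshift : ∑ k, (w (k + 1)).val = ∑ k, (w k).val :=
    Fintype.sum_equiv (Equiv.addRight (1 : ZMod p)) _ _ fun k => rfl
  simp only [Finset.sum_add_distrib, ← Finset.mul_sum, hshift, Finset.sum_const,
    Finset.card_univ, ZMod.card, smul_eq_mul] at hsum
  omega

/-- The non-constant walks contribute a constant to the trace: rotating a walk translates its
polynomial, and a sum of a polynomial of degree `< 2 * p - 1` over all translates is constant. -/
lemma sum_eval_walkPoly_nonconst (hodd : p ≠ 2) (B : Matrix (Fin 2) (Fin 2) (Polynomial K))
    (hB : ∀ i j, 2 * (B i j).natDegree + j.val ≤ 3 + i.val) (x : K) :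
    ∑ w : ZMod p → Fin 2 with w ≠ 0 ∧ w ≠ 1,
      ((walkPoly B w).eval x - (walkPoly B w).eval 0) = 0 := by
  classical
  set N : (ZMod p → Fin 2) → ℕ := fun w => (Finset.univ.filter fun k => w k = 1).card with hN
  set Δ : (ZMod p → Fin 2) → K := fun w => (walkPoly B w).eval x - (walkPoly B w).eval 0 with hΔ
  have hNK : ∀ w : ZMod p → Fin 2, w ≠ 0 ∧ w ≠ 1 → (N w : K) ≠ 0 := by
    rintro w ⟨h0, h1⟩ h
    rw [CharP.cast_eq_zero_iff K p] at h
    have hle : N w ≤ p := (Finset.card_le_univ _).trans_eq (ZMod.card p)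
    rcases Nat.eq_zero_or_pos (N w) with hz | hpos
    · refine h0 (_root_.funext fun k => ?_)
      have := Finset.filter_eq_empty_iff.1 (Finset.card_eq_zero.1 hz) (Finset.mem_univ k)
      simp only [Pi.zero_apply]
      omega
    · have hc : N w = Fintype.card (ZMod p) := by
        rw [ZMod.card]; exact le_antisymm hle (Nat.le_of_dvd hpos h)
      refine h1 (_root_.funext fun k => ?_)
      have := (Finset.card_eq_iff_eq_univ _).1 hc
      have hk : k ∈ Finset.univ.filter fun k => w k = 1 := by
        rw [this]; exact Finset.mem_univ k
      exact (Finset.mem_filter.1 hk).2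
  have hNshift : ∀ (w : ZMod p → Fin 2) (s : ZMod p), N (fun k => w (k - s)) = N w := by
    intro w s
    refine Finset.card_equiv (Equiv.subRight s) fun k => ?_
    simp
  calc ∑ w with w ≠ 0 ∧ w ≠ 1, Δ w
      = ∑ w with w ≠ 0 ∧ w ≠ 1, ∑ k, if w k = 1 then (N w : K)⁻¹ * Δ w else 0 := by
        refine Finset.sum_congr rfl fun w hw => ?_
        have := hNK w (Finset.mem_filter.1 hw).2
        rw [← Finset.sum_filter, Finset.sum_const, nsmul_eq_mul, mul_inv_cancel_left₀ this]
    _ = ∑ k : ZMod p, ∑ w with w ≠ 0 ∧ w ≠ 1, if w k = 1 then (N w : K)⁻¹ * Δ w else 0 :=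
        Finset.sum_comm
    _ = ∑ k : ZMod p, ∑ w with w ≠ 0 ∧ w ≠ 1, if w 0 = 1 then
          (N w : K)⁻¹ * Δ (fun l => w (l - k)) else 0 := by
        refine Finset.sum_congr rfl fun k _ => Eq.symm ?_
        let σ := ((Equiv.subRight k).arrowCongr (Equiv.refl (Fin 2))).symm
        have hσ : ∀ w, σ w = fun l => w (l - k) := fun w => rfl
        refine Finset.sum_equiv σ ?_ ?_
        · intro w
          have h0 : σ w = 0 ↔ w = 0 := σ.apply_eq_iff_eq (y := 0)
          have h1 : σ w = 1 ↔ w = 1 := σ.apply_eq_iff_eq (y := 1)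
          simp [h0, h1]
        · intro w _
          simp only [hσ, sub_self, hNshift]
    _ = ∑ w with w ≠ 0 ∧ w ≠ 1, if w 0 = 1 then
          (N w : K)⁻¹ * ∑ k : ZMod p, Δ (fun l => w (l - k)) else 0 := by
        rw [Finset.sum_comm]
        refine Finset.sum_congr rfl fun w _ => ?_
        split_ifs <;> simp [Finset.mul_sum]
    _ = 0 := by
        refine Finset.sum_eq_zero fun w _ => ?_
        have hz : ∑ k : ZMod p, Δ (fun l => w (l - k)) = 0 := by
          simp only [hΔ, eval_walkPoly_shift, Finset.sum_sub_distrib, zero_add]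
          rw [sum_eval_add_cast _ (natDegree_walkPoly_lt hodd B hB w), sub_self]
        rw [hz, mul_zero, ite_self]

lemma trace_prod_eq_sum_walkPoly (B : Matrix (Fin 2) (Fin 2) (Polynomial K)) (x : K) :
    (((List.range p).reverse.map fun k : ℕ => B.map (Polynomial.eval (k + x))).prod).trace =
      ∑ w : ZMod p → Fin 2, (walkPoly B w).eval x := by
  obtain ⟨n, rfl⟩ : ∃ n, p = n + 1 :=
    ⟨p - 1, by have := (Fact.out : p.Prime).one_lt; omega⟩
  rw [trace_list_prod_eq_sum]
  refine Finset.sum_congr rfl fun w _ => ?_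
  rw [eval_walkPoly]
  refine Finset.prod_congr rfl fun k _ => ?_
  rw [Matrix.map_apply, add_comm, ← map_natCast (ZMod.castHom (dvd_refl (n + 1)) K),
    ZMod.natCast_zmod_val]

end ArtinSchreier

lemma trace_reduced_sub (p : ℕ) [Fact p.Prime] (hodd : p ≠ 2) {K : Type*} [Field K] [CharP K p]
    (a b c d e x : K) :
    (((List.range p).reverse.map fun k : ℕ => reducedLaxMatrix a b c d e (k + x)).prod).trace =
      (((List.range p).reverse.map fun k : ℕ => reducedLaxMatrix a b c d e (k : K)).prod).trace
        + e ^ p * (x ^ p - x) := by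
  classical
  set B : Matrix (Fin 2) (Fin 2) (Polynomial K) :=
    reducedLaxMatrix (Polynomial.C a) (Polynomial.C b) (Polynomial.C c) (Polynomial.C d)
      (Polynomial.C e) Polynomial.X with hBdef
  have heval : ∀ y : K, reducedLaxMatrix a b c d e y = B.map (Polynomial.eval y) := by
    intro y
    ext i j
    fin_cases i <;> fin_cases j <;> simp [hBdef, reducedLaxMatrix]
  have hB : ∀ i j, 2 * (B i j).natDegree + j.val ≤ 3 + i.val := by
    have h00 : (B 0 0).natDegree ≤ 0 := by
      simp only [hBdef, reducedLaxMatrix, Matrix.of_apply, Matrix.cons_val]; compute_degree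
    have h01 : (B 0 1).natDegree ≤ 1 := by
      simp only [hBdef, reducedLaxMatrix, Matrix.of_apply, Matrix.cons_val]; compute_degree
    have h10 : (B 1 0).natDegree ≤ 2 := by
      simp only [hBdef, reducedLaxMatrix, Matrix.of_apply, Matrix.cons_val]; compute_degree
    have h11 : (B 1 1).natDegree ≤ 1 := by
      simp only [hBdef, reducedLaxMatrix, Matrix.of_apply, Matrix.cons_val]; compute_degree
    intro i j
    fin_cases i <;> fin_cases j <;> simp <;> omega
  have h0 : (walkPoly B (0 : ZMod p → Fin 2)).eval x =
      (walkPoly B (0 : ZMod p → Fin 2)).eval 0 := by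
    simp [eval_walkPoly, hBdef, reducedLaxMatrix]
  have h1 : (walkPoly B (1 : ZMod p → Fin 2)).eval x =
      (walkPoly B (1 : ZMod p → Fin 2)).eval 0 + e ^ p * (x ^ p - x) := by
    have hy : ∀ y : K, (walkPoly B (1 : ZMod p → Fin 2)).eval y =
        (e * y + (-d * a - a ^ 2 * b - e * (a * b))) ^ p -
          e ^ (p - 1) * (e * y + (-d * a - a ^ 2 * b - e * (a * b))) := by
      intro y
      rw [eval_walkPoly, ← prod_add_mul_cast]
      refine Finset.prod_congr rfl fun k _ => ?_
      simp [hBdef, reducedLaxMatrix]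
      ring
    have he : e ^ p = e ^ (p - 1) * e := by
      rw [← pow_succ, Nat.sub_add_cancel (Fact.out : p.Prime).one_le]
    rw [hy, hy, add_pow_char, mul_pow, he, mul_zero, zero_add]
    ring
  have hne : (0 : ZMod p → Fin 2) ≠ 1 := fun h => by simpa using congrFun h 0
  have hsplit : ∀ F : (ZMod p → Fin 2) → K,
      ∑ w, F w = F 0 + F 1 + ∑ w with w ≠ 0 ∧ w ≠ 1, F w := by
    intro F
    have : (Finset.univ.filter fun w : ZMod p → Fin 2 => w ≠ 0 ∧ w ≠ 1) =
        ({0, 1} : Finset (ZMod p → Fin 2))ᶜ := by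
      ext w; simp
    rw [this, ← Finset.sum_pair hne, Finset.sum_add_sum_compl]
  have hx := trace_prod_eq_sum_walkPoly (p := p) B x
  have hz := trace_prod_eq_sum_walkPoly (p := p) B 0
  have hnc := sum_eval_walkPoly_nonconst hodd B hB x
  rw [Finset.sum_sub_distrib] at hnc
  simp only [add_zero] at hz
  simp only [heval]
  rw [hx, hz, hsplit, hsplit fun w => (walkPoly B w).eval 0]
  linear_combination h0 + h1 + hnc

end

/-- For odd primes `p`, the Weyl group generator `s₁` maps the integral
of motion `I_p` to `I_p + t^p·(α₁^p − α₁)`. -/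
theorem Ip_s1_action (p : ℕ) (hp : p.Prime) (hodd : p ≠ 2) (K : Type*) [Field K] [CharP K p]
    (a b c d e : K) (ha : a ≠ 0) :
    evalP p (Ip p) K a (b - c / a) (-c) (d + c) e
    = evalP p (Ip p) K a b c d e + e ^ p * (c ^ p - c) := by
  have : Fact p.Prime := ⟨hp⟩
  simp only [evalP_Ip_eq_trace_reduced, reducedLaxMatrix_s1 _ _ _ _ _ _ ha]
  exact trace_reduced_sub p hodd a b c d e c
end

section
/- Let p be a prime and let Z be an indeterminate over R. Substituting the polynomial Z for z, regard A(Z) as a 2×2 matrix over R[Z]. Then the determinant of A(Z) equals −Z·(Z − α₁)·(Z + α₂) in R[Z]. -/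
open MvPolynomial

/-- The determinant of the Lax matrix `A(Z)`, regarded as a `2×2` matrix
over `R[Z]`, equals `−Z·(Z − α₁)·(Z + α₂)`. -/
theorem A_det (p : ℕ) (hp : p.Prime) :
    Matrix.det (AM p (Polynomial.C : R p →+* Polynomial (R p)) Polynomial.X)
    = -(Polynomial.X * (Polynomial.X - Polynomial.C (a1P p))
        * (Polynomial.X + Polynomial.C (a2P p))) := by
  simp only [Matrix.det_fin_two, AM, A0, A1, A2, A3, hP, Matrix.add_apply, Matrix.smul_apply,
    Matrix.map_apply, Matrix.of_apply, Matrix.cons_val', Matrix.cons_val_zero,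
    Matrix.cons_val_one, Matrix.cons_val_fin_one, smul_eq_mul, map_add, map_sub, map_mul,
    map_neg, map_pow, map_one, map_zero]
  ring
end

section
/- Let p be a prime, let S = 𝔽_p[x, y, α₁, α₂, t] be the polynomial ring in four further indeterminates together with α₁, α₂, t, and let L be its field of fractions. Then: (i) the element of L obtained by evaluating the polynomial I_p at (f, g, α₁, α₂, t) = (x⁻¹, x·(−α₂ + x·y), α₁, α₂, t) lies in the image of S in L, i.e. it is a polynomial in x, y, α₁, α₂, t; and (ii) likewise the evaluation of I_p at (f, g, α₁, α₂, t) = (x·(α₁ + x·y), x⁻¹, α₁, α₂, t) lies in the image of S in L. (In the local coordinates covering the exceptional curves E₂ and E₄ of the space of initial values away from the anticanonical divisor, the integral of motion I_p extends polynomially.) -/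
open MvPolynomial

/-- If a ring homomorphism sends the entries of `A₀`, and `h`, `f·g`, `t`, into a subring,
then it sends `I_p` into that subring. -/
theorem map_Ip_mem {p : ℕ} {L : Type*} [CommRing L] (K : Subring L) (φ : R p →+* L)
    (hA0 : ∀ i j, φ (A0 p i j) ∈ K) (hh : φ (hP p) ∈ K) (hfg : φ (fP p * gP p) ∈ K)
    (ht : φ (tP p) ∈ K) : φ (Ip p) ∈ K := by
  have hA1 : ∀ i j, φ (A1 p i j) ∈ K := by
    intro i j
    fin_cases i <;> fin_cases j <;> simp [A1, K.zero_mem, K.one_mem, hh]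
  have hA2 : ∀ i j, φ (A2 p i j) ∈ K := by
    have h21 : φ (1 - tP p ^ 2 * fP p * gP p) ∈ K := by
      rw [mul_assoc, map_sub, map_mul, map_one, map_pow]
      exact K.sub_mem K.one_mem (K.mul_mem (K.pow_mem ht 2) hfg)
    have h22 : φ (-tP p) ∈ K := by
      rw [map_neg]
      exact K.neg_mem ht
    intro i j
    fin_cases i <;> fin_cases j
    exacts [ht, (map_zero φ).symm ▸ K.zero_mem, h21, h22]
  have hA3 : ∀ i j, φ (A3 p i j) ∈ K := by
    have h21 : φ (-(tP p ^ 2)) ∈ K := by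
      rw [map_neg, map_pow]
      exact K.neg_mem (K.pow_mem ht 2)
    have h0 : φ 0 ∈ K := (map_zero φ).symm ▸ K.zero_mem
    intro i j
    fin_cases i <;> fin_cases j
    exacts [h0, h0, h21, h0]
  have hfactor : ∀ k : ℕ, φ.mapMatrix (AM p (RingHom.id (R p)) (k : R p)) ∈ K.matrix := by
    intro k i j
    simp only [AM, RingHom.mapMatrix_apply, Matrix.map_apply, Matrix.add_apply,
      Matrix.smul_apply, RingHom.id_apply, smul_eq_mul, map_add, map_mul, map_pow, map_natCast]
    have hk : (k : L) ∈ K := natCast_mem K k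
    exact K.add_mem (K.add_mem (K.add_mem (hA0 i j) (K.mul_mem hk (hA1 i j)))
      (K.mul_mem (K.pow_mem hk 2) (hA2 i j))) (K.mul_mem (K.pow_mem hk 3) (hA3 i j))
  rw [Ip, Matrix.trace, map_sum]
  refine K.sum_mem fun i _ => ?_
  refine (?_ : φ.mapMatrix (List.prod _) ∈ K.matrix) i i
  rw [map_list_prod, List.map_map]
  refine Subring.list_prod_mem _ fun M hM => ?_
  obtain ⟨z, hz, rfl⟩ := List.mem_map.1 hM
  obtain ⟨k, -, hk⟩ := List.mem_flatMap.1 hz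
  obtain rfl : z = k := List.mem_singleton.1 hk
  exact hfactor k

/-- A ring homomorphism sends `I_p` into a subring as soon as it sends `α₁`, `α₂`, `t`, `f·g`,
`h`, `g·(f·g − α₁)` and `f·(f·g + α₂)` into it, even if `f` or `g` itself is not sent there. -/
theorem map_Ip_mem_of_coords {p : ℕ} {L : Type*} [CommRing L] (K : Subring L)
    (φ : R p →+* L) (ha1 : φ (a1P p) ∈ K) (ha2 : φ (a2P p) ∈ K) (ht : φ (tP p) ∈ K)
    (hfg : φ (fP p * gP p) ∈ K) (hh : φ (hP p) ∈ K)
    (hg : φ (gP p * (fP p * gP p - a1P p)) ∈ K)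
    (hf : φ (fP p * (fP p * gP p + a2P p)) ∈ K) : φ (Ip p) ∈ K := by
  refine map_Ip_mem K φ (fun i j => ?_) hh hfg ht
  have htfg : φ (tP p * (fP p * gP p) ^ 2) ∈ K := by
    rw [map_mul, map_pow]
    exact K.mul_mem ht (K.pow_mem hfg 2)
  fin_cases i <;> fin_cases j
  · convert K.sub_mem hg htfg using 1
    rw [← map_sub]
    exact congrArg φ (by simp [A0]; ring)
  · convert K.neg_mem hfg using 1
    rw [← map_neg]
    exact congrArg φ (by simp [A0])
  · convert K.sub_mem (K.mul_mem hfg hh) (K.mul_mem ha1 ha2) using 1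
    rw [← map_mul, ← map_mul, ← map_sub]
    exact congrArg φ (by simp [A0])
  · convert K.sub_mem htfg hf using 1
    rw [← map_sub]
    exact congrArg φ (by simp [A0]; ring)

/-- With `S = 𝔽_p[x, y, α₁, α₂, t]` (here realised as `R` with `x, y`
playing the roles of the first two indeterminates) and `L = Frac(S)`, the evaluations of
`I_p` at `(f, g) = (x⁻¹, x·(−α₂ + x·y))` and at `(f, g) = (x·(α₁ + x·y), x⁻¹)` are
polynomials in `x, y, α₁, α₂, t`: the integral of motion extends polynomially to the
exceptional curves `E₂` and `E₄` of the space of initial values. -/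
theorem Ip_polynomial_on_E2_E4 (p : ℕ) [Fact p.Prime] :
    (eval₂ ((algebraMap (R p) (FractionRing (R p))).comp (C : ZMod p →+* R p))
        ![(algebraMap (R p) (FractionRing (R p)) (X 0))⁻¹,
          algebraMap (R p) (FractionRing (R p)) (X 0 * (-(X 3) + X 0 * X 1)),
          algebraMap (R p) (FractionRing (R p)) (X 2),
          algebraMap (R p) (FractionRing (R p)) (X 3),
          algebraMap (R p) (FractionRing (R p)) (X 4)] (Ip p)
      ∈ Set.range (algebraMap (R p) (FractionRing (R p)))) ∧
    (eval₂ ((algebraMap (R p) (FractionRing (R p))).comp (C : ZMod p →+* R p))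
        ![algebraMap (R p) (FractionRing (R p)) (X 0 * (X 2 + X 0 * X 1)),
          (algebraMap (R p) (FractionRing (R p)) (X 0))⁻¹,
          algebraMap (R p) (FractionRing (R p)) (X 2),
          algebraMap (R p) (FractionRing (R p)) (X 3),
          algebraMap (R p) (FractionRing (R p)) (X 4)] (Ip p)
      ∈ Set.range (algebraMap (R p) (FractionRing (R p)))) := by
  set ι := algebraMap (R p) (FractionRing (R p)) with hι
  have hx : ι (X 0) ≠ 0 := by
    rw [hι, Ne, FaithfulSMul.algebraMap_eq_zero_iff]
    exact X_ne_zero 0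
  constructor
  · refine map_Ip_mem_of_coords ι.range (eval₂Hom (ι.comp C) _) ⟨X 2, ?_⟩ ⟨X 3, ?_⟩ ⟨X 4, ?_⟩
      ⟨-X 3 + X 0 * X 1, ?_⟩
      ⟨(X 4 - X 0) * (X 4 * (-X 3 + X 0 * X 1) ^ 2 - X 1)
        + X 2 * (X 4 * X 0 * (-X 3 + X 0 * X 1) - 1), ?_⟩
      ⟨X 0 * (-X 3 + X 0 * X 1) * (-X 3 + X 0 * X 1 - X 2), ?_⟩ ⟨X 1, ?_⟩ <;>
    simp [hP, fP, gP, a1P, a2P, tP, -mul_eq_mul_left_iff] <;> field_simp <;> ring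
  · refine map_Ip_mem_of_coords ι.range (eval₂Hom (ι.comp C) _) ⟨X 2, ?_⟩ ⟨X 3, ?_⟩ ⟨X 4, ?_⟩
      ⟨X 2 + X 0 * X 1, ?_⟩
      ⟨(X 4 - X 0) * (X 4 * (X 2 + X 0 * X 1) ^ 2 - X 1)
        - X 3 * (X 4 * X 0 * (X 2 + X 0 * X 1) - 1), ?_⟩
      ⟨X 1, ?_⟩ ⟨X 0 * (X 2 + X 0 * X 1) * (X 2 + X 0 * X 1 + X 3), ?_⟩ <;>
    simp [hP, fP, gP, a1P, a2P, tP, -mul_eq_mul_left_iff] <;> field_simp <;> ring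
end

section
/- Let p be a prime and let q be a polynomial over 𝔽_p = ZMod p of degree at most 2p − 2. Then the cyclic sum ∑_{n=0}^{p−1} q(X + n) equals the constant polynomial −(c_{p−1} + c_{2p−2}), where c_j denotes the coefficient of X^j in q and q(X + n) denotes the composition of q with the polynomial X + n. -/
/-- Power sums over `𝔽_p` with exponent at most `2p − 2` vanish unless the exponent is a positive
multiple of `p − 1`, in which case they equal `-1`. -/
theorem ZMod.sum_pow_eq_of_le (p : ℕ) [Fact p.Prime] (j : ℕ) (hj : j ≤ 2 * p - 2) :
    ∑ x : ZMod p, x ^ j = -((if j = p - 1 then 1 else 0) + (if j = 2 * p - 2 then 1 else 0)) := by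
  have hp : 2 ≤ p := (Fact.out : p.Prime).two_le
  rcases Nat.eq_zero_or_pos j with rfl | hj0
  · rw [if_neg (by lia), if_neg (by lia)]
    simp
  · have hsum : ∑ x : ZMod p, x ^ j = ∑ u : (ZMod p)ˣ, (u : ZMod p) ^ j := by
      rw [← Fintype.sum_subtype_add_sum_subtype (fun x : ZMod p => x ≠ 0)]
      rw [Fintype.sum_equiv unitsEquivNeZero (fun u : (ZMod p)ˣ => (u : ZMod p) ^ j)
        (fun x => (x : ZMod p) ^ j) (fun _ => rfl)]
      refine add_eq_left.mpr (Finset.sum_eq_zero fun x _ => ?_)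
      rw [not_not.mp x.2, zero_pow hj0.ne']
    have hunits := FiniteField.sum_pow_units (ZMod p) j
    rw [ZMod.card] at hunits
    rw [hsum, hunits]
    by_cases h : p - 1 ∣ j
    · rw [if_pos h]
      obtain ⟨c, rfl⟩ := h
      have hc : c ≤ 2 := by
        by_contra! hc
        have := Nat.mul_le_mul_left (p - 1) hc
        lia
      interval_cases c
      · lia
      · rw [if_pos (by lia), if_neg (by lia), add_zero]
      · rw [if_neg (by lia), if_pos (by lia), zero_add]
    · rw [if_neg h, if_neg, if_neg, add_zero, neg_zero]
      · rintro rfl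
        exact h ⟨2, by lia⟩
      · rintro rfl
        exact h dvd_rfl

/-- The cyclic shift sum of the monomial `X ^ k`, for `k ≤ 2p − 2`. -/
theorem ZMod.sum_X_add_C_pow_of_le (p : ℕ) [Fact p.Prime] (k : ℕ) (hk : k ≤ 2 * p - 2) :
    ∑ x : ZMod p, (Polynomial.X + Polynomial.C x) ^ k =
      Polynomial.C (-((if k = p - 1 then 1 else 0) + (if k = 2 * p - 2 then 1 else 0))) := by
  have hp : 2 ≤ p := (Fact.out : p.Prime).two_le
  have hexpand : ∑ x : ZMod p, (Polynomial.X + Polynomial.C x) ^ k =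
      ∑ m ∈ Finset.range (k + 1), Polynomial.C (∑ x : ZMod p, x ^ m) *
        (Polynomial.X ^ (k - m) * Polynomial.C (k.choose m : ZMod p)) := by
    simp_rw [add_comm Polynomial.X, add_pow]
    rw [Finset.sum_comm]
    refine Finset.sum_congr rfl fun m _ => ?_
    simp [Finset.sum_mul, mul_assoc]
  rw [hexpand, Finset.sum_eq_single_of_mem k (by simp)]
  · simp [ZMod.sum_pow_eq_of_le p k hk]
  · intro m hm hmk
    rw [Finset.mem_range] at hm
    by_cases hmp : m = p - 1
    · have hdvd : p ∣ k.choose m := by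
        have := (Fact.out : p.Prime).dvd_choose_add (a := m) (b := k - m)
          (by lia) (by lia) (by lia)
        rwa [Nat.add_sub_cancel' (by lia)] at this
      rw [(ZMod.natCast_eq_zero_iff _ _).mpr hdvd]
      simp
    · rw [ZMod.sum_pow_eq_of_le p m (by lia), if_neg hmp, if_neg (by lia)]
      simp

/-- cyclic shift sum. For a polynomial `q` over `𝔽_p` of degree at most
`2p − 2`, the cyclic sum `∑_{n=0}^{p−1} q(X + n)` equals the constant polynomial
`−(c_{p−1} + c_{2p−2})`, where `c_j` is the coefficient of `X^j` in `q`. -/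
theorem sum_comp_shift_eq_const (p : ℕ) (hp : p.Prime) (q : Polynomial (ZMod p))
    (hq : q.natDegree ≤ 2 * p - 2) :
    ∑ n ∈ Finset.range p, q.comp (Polynomial.X + Polynomial.C (n : ZMod p))
    = Polynomial.C (-(q.coeff (p - 1) + q.coeff (2 * p - 2))) := by
  have : Fact p.Prime := ⟨hp⟩
  have hp2 := hp.two_le
  have hrange : ∑ n ∈ Finset.range p, q.comp (Polynomial.X + Polynomial.C (n : ZMod p)) =
      ∑ x : ZMod p, q.comp (Polynomial.X + Polynomial.C x) := by
    refine Finset.sum_bij (fun n _ => (n : ZMod p)) (by simp) ?_ ?_ (by simp)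
    · intro a ha b hb hab
      rw [Finset.mem_range] at ha hb
      rwa [ZMod.natCast_eq_natCast_iff', Nat.mod_eq_of_lt ha, Nat.mod_eq_of_lt hb] at hab
    · exact fun x _ => ⟨x.val, Finset.mem_range.mpr x.val_lt, ZMod.natCast_zmod_val x⟩
  have hcomp : ∀ x : ZMod p, q.comp (Polynomial.X + Polynomial.C x) =
      ∑ k ∈ Finset.range (2 * p - 1),
        Polynomial.C (q.coeff k) * (Polynomial.X + Polynomial.C x) ^ k := fun x =>
    Polynomial.eval₂_eq_sum_range' _ (by lia) _
  simp_rw [hrange, hcomp]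
  rw [Finset.sum_comm]
  have hterm : ∀ k ∈ Finset.range (2 * p - 1),
      ∑ x : ZMod p, Polynomial.C (q.coeff k) * (Polynomial.X + Polynomial.C x) ^ k =
        Polynomial.C (-((if k = p - 1 then q.coeff k else 0) +
          (if k = 2 * p - 2 then q.coeff k else 0))) := by
    intro k hk
    rw [Finset.mem_range] at hk
    rw [← Finset.mul_sum, ZMod.sum_X_add_C_pow_of_le p k (by lia), ← Polynomial.C_mul]
    simp only [mul_neg, mul_add, mul_ite, mul_one, mul_zero]
  rw [Finset.sum_congr rfl hterm, ← map_sum, Finset.sum_neg_distrib, Finset.sum_add_distrib,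
    Finset.sum_ite_eq', Finset.sum_ite_eq', if_pos (Finset.mem_range.mpr (by lia)),
    if_pos (Finset.mem_range.mpr (by lia))]
end

section
/- Let p be a prime. Let σ₁ : R → R be the ring homomorphism substituting α₁ ↦ 0 (and fixing f, g, α₂, t), and let σ₂ : R → R be the ring homomorphism substituting α₂ ↦ 0 (and fixing f, g, α₁, t). Then f divides σ₁(I_p) in R and g divides σ₂(I_p) in R. (These divisibilities produce reducible fibres of the integral of motion, corresponding to the reductions of the fourth Painlevé equation to Riccati equations when α₁ = 0 or α₂ = 0.) -/
open MvPolynomial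

theorem AM_id_zero (p : ℕ) : AM p (RingHom.id (R p)) 0 = A0 p := by
  ext i j
  simp [AM]

/-- `A(0) = A₀` is the rightmost factor of the product defining `I_p`, so a common divisor of
the entries of `σ(A₀)` divides `σ(I_p)`. -/
theorem dvd_map_Ip {S : Type*} [CommRing S] {p : ℕ} (hp : p ≠ 0) (σ : R p →+* S) (d : S)
    (hd : ∀ i j, d ∣ σ (A0 p i j)) : d ∣ σ (Ip p) := by
  obtain ⟨n, hn⟩ := Nat.exists_eq_succ_of_ne_zero hp
  have hlist : (List.range p).reverse = ((List.range n).map Nat.succ).reverse ++ [0] := by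
    rw [hn, Nat.succ_eq_add_one, List.range_succ_eq_map, List.reverse_cons]
  rw [Ip, hlist, List.bind_eq_flatMap, List.flatMap_append, List.flatMap_singleton,
    List.pure_def, List.map_append, List.prod_append, List.map_singleton, List.prod_singleton,
    Nat.cast_zero, AM_id_zero, Matrix.trace, map_sum]
  refine Finset.dvd_sum fun i _ => ?_
  rw [Matrix.diag_apply, Matrix.mul_apply, map_sum]
  refine Finset.dvd_sum fun j _ => ?_
  rw [map_mul]
  exact (hd j i).mul_left _

/-- Let `σ₁ : R → R` substitute `α₁ ↦ 0` and `σ₂ : R → R` substitute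
`α₂ ↦ 0` (fixing the other indeterminates). Then `f ∣ σ₁(I_p)` and `g ∣ σ₂(I_p)`:
the fibres of the integral of motion become reducible on the Riccati loci `α₁ = 0`
and `α₂ = 0`. -/
theorem Ip_reducible_riccati (p : ℕ) (hp : p.Prime) :
    fP p ∣ eval₂ (C : ZMod p →+* R p) (Function.update X (2 : Fin 5) 0) (Ip p) ∧
    gP p ∣ eval₂ (C : ZMod p →+* R p) (Function.update X (3 : Fin 5) 0) (Ip p) := by
  refine ⟨dvd_map_Ip hp.ne_zero (eval₂Hom C (Function.update X 2 0)) _ fun i j => ?_,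
    dvd_map_Ip hp.ne_zero (eval₂Hom C (Function.update X 3 0)) _ fun i j => ?_⟩
  all_goals
    fin_cases i <;> fin_cases j <;>
      simp (maxDischargeDepth := 8) [A0, fP, gP, a1P, a2P, tP, pow_two, mul_assoc, dvd_add,
        dvd_sub, Dvd.dvd.mul_left]
end

section
/- Let p be an odd prime and let He_n ∈ ℤ[X] denote the probabilists' Hermite polynomials, defined by He₀ = 1 and He_{n+1} = X·He_n − derivative(He_n) (equivalently He₀ = 1, He₁ = X, He_{n+1} = X·He_n − n·He_{n−1}). Then for every natural number n, the reduction of He_{n+p} modulo p equals X^p times the reduction of He_n modulo p; that is, in (ZMod p)[X] one has He_{n+p} = X^p · He_n. -/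
open Polynomial

/-- The probabilists' Hermite polynomials, `He₀ = 1`, `He_{n+1} = X·He_n − (He_n)'`. -/
noncomputable def He : ℕ → Polynomial ℤ
  | 0 => 1
  | n + 1 => X * He n - derivative (He n)

theorem He_eq_hermite (n : ℕ) : He n = hermite n := by
  induction n with
  | zero => simp [He]
  | succ n ih => rw [He, hermite_succ, ih]

/-- For an odd prime `p`, the `p`-th Hermite polynomial reduces to `X ^ p` modulo `p`. -/
theorem map_hermite_prime {p : ℕ} (hp : p.Prime) (hodd : p ≠ 2) :
    (hermite p).map (Int.castRingHom (ZMod p)) = X ^ p := by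
  ext k
  rw [coeff_map, coeff_X_pow]
  rcases lt_trichotomy k p with hk | rfl | hk
  · rw [if_neg hk.ne, coeff_hermite]
    split_ifs with heven
    · have hk0 : k ≠ 0 := by
        rintro rfl
        exact Nat.not_even_iff_odd.2 (hp.odd_of_ne_two hodd) heven
      have hchoose : (p.choose k : ZMod p) = 0 :=
        (ZMod.natCast_eq_zero_iff _ _).2 (hp.dvd_choose_self hk0 hk)
      simp [hchoose]
    · simp
  · simp [coeff_hermite_self]
  · simp [coeff_hermite_of_lt hk, hk.ne']

/-- For an odd prime `p` and every `n`, the reduction of `He_{n+p}`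
modulo `p` equals `X^p` times the reduction of `He_n` modulo `p`. -/
theorem hermite_reduction_periodicity (p : ℕ) (hp : p.Prime) (hodd : p ≠ 2) (n : ℕ) :
    (He (n + p)).map (Int.castRingHom (ZMod p))
    = X ^ p * (He n).map (Int.castRingHom (ZMod p)) := by
  induction n with
  | zero => simp [He_eq_hermite, map_hermite_prime hp hodd]
  | succ n ih =>
    have hderiv : derivative (X ^ p : (ZMod p)[X]) = 0 := by simp [derivative_X_pow]
    rw [Nat.add_right_comm, He, He, Polynomial.map_sub, Polynomial.map_sub, Polynomial.map_mul,
      Polynomial.map_mul, ← derivative_map, ← derivative_map, ih, derivative_mul, hderiv, map_X]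
    ring
end
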